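/- arXiv:1501.00190 — 5 statements merged into one kernel-verified Lean document; each statement's English description precedes it below -/
import Mathlib

section
/- Let Q be a Markov kernel on ℝ^d satisfying the drift condition (A4): there exist c > 0, ρ ∈ (0,1), R > 0, K > 0 such that ∫ e^{c|x'|} Q(x,dx') ≤ ρ e^{c|x|} for all |x| ≥ R and ∫ e^{c|x'|} Q(x,dx') ≤ K for all |x| ≤ R. Let (X_t)_{t≥0} be the Markov chain with kernel Q started at X₀ = x, and let τ̂_R = inf{t ≥ 0 : |X_t| ≤ R}. Then there exist constants C, λ > 0 such that E_x exp(λ τ̂_R) ≤ C e^{c|x|} for every x ∈ ℝ^d. -/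
open MeasureTheory ProbabilityTheory ENNReal

noncomputable section

/-- The Euclidean state space `ℝ^d`. -/
abbrev St (d : ℕ) : Type := EuclideanSpace ℝ (Fin d)

/-- Exponential weight `e^{c‖x‖}` viewed in `ℝ≥0∞`. -/
def expW {d : ℕ} (c : ℝ) (x : St d) : ℝ≥0∞ := ENNReal.ofReal (Real.exp (c * ‖x‖))

/-- Drift condition (A4) for a kernel `Q`. -/
def DriftCond {d : ℕ} (Q : Kernel (St d) (St d)) (c ρ R K : ℝ) : Prop :=
  (∀ x : St d, R ≤ ‖x‖ →
      ∫⁻ x', expW c x' ∂(Q x) ≤ ENNReal.ofReal (ρ * Real.exp (c * ‖x‖))) ∧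
  (∀ x : St d, ‖x‖ ≤ R → ∫⁻ x', expW c x' ∂(Q x) ≤ ENNReal.ofReal K)

/-- One step of the non-normalized filter: prediction by `Q`, then weighting by `Ψ(·, y)`. -/
def step {d l : ℕ} (Q : Kernel (St d) (St d)) (Ψ : St d → St l → ℝ) (y : St l)
    (μ : Measure (St d)) : Measure (St d) :=
  (μ.bind fun x => Q x).withDensity fun x' => ENNReal.ofReal (Ψ x' y)

/-- Non-normalized filtering operator along a list of observations
(the observations are applied in chronological order). -/
def nnFilter {d l : ℕ} (Q : Kernel (St d) (St d)) (Ψ : St d → St l → ℝ)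
    (ys : List (St l)) (μ : Measure (St d)) : Measure (St d) :=
  ys.foldl (fun m y => step Q Ψ y m) μ

/-- Normalization of a measure. -/
def normalizeM {α : Type*} [MeasurableSpace α] (μ : Measure α) : Measure α :=
  (μ Set.univ)⁻¹ • μ

/-- Normalized filtering operator `μ S̄_{k:n}`. -/
def nFilter {d l : ℕ} (Q : Kernel (St d) (St d)) (Ψ : St d → St l → ℝ)
    (ys : List (St l)) (μ : Measure (St d)) : Measure (St d) :=
  normalizeM (nnFilter Q Ψ ys μ)

/-- One-step normalized update `μ ↦ μ Q̄^y`. -/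
def stepBar {d l : ℕ} (Q : Kernel (St d) (St d)) (Ψ : St d → St l → ℝ) (y : St l)
    (μ : Measure (St d)) : Measure (St d) :=
  normalizeM (step Q Ψ y μ)

/-- The conditional kernel `Q̄^{y,μ}(x, dx') = Q(x,dx') Ψ(x',y) / ∬ Q(x̃,dx₁) Ψ(x₁,y) μ(dx̃)`. -/
def condBar {d l : ℕ} (Q : Kernel (St d) (St d)) (Ψ : St d → St l → ℝ) (y : St l)
    (μ : Measure (St d)) (x : St d) : Measure (St d) :=
  (step Q Ψ y μ Set.univ)⁻¹ • ((Q x).withDensity fun x' => ENNReal.ofReal (Ψ x' y))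

/-- Total variation distance between two measures. -/
def tvDist {α : Type*} [MeasurableSpace α] (μ ν : Measure α) : ℝ≥0∞ :=
  ⨆ A : Set α, ((μ A - ν A) + (ν A - μ A))

/-- Birkhoff (Hilbert, projective) distance between two measures. -/
def birkhoffDist {α : Type*} [MeasurableSpace α] (μ ν : Measure α) : ℝ≥0∞ :=
  ⨅ (s : ℝ) (t : ℝ) (_ : 0 < t)
    (_ : ∀ A : Set α, μ A ≤ ENNReal.ofReal s * ν A)
    (_ : ∀ A : Set α, ENNReal.ofReal t * ν A ≤ μ A),
    ENNReal.ofReal (Real.log (s / t))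

/-- Expectation of a functional of the observations `Y_{1:n}` under the exact model
started from `μ₀`: the joint density of `Y_{1:n}` at `y` is the total mass of the
non-normalized filter. -/
def obsExp {d l : ℕ} (Q : Kernel (St d) (St d)) (Ψ : St d → St l → ℝ)
    (μ₀ : Measure (St d)) (n : ℕ) (f : (Fin n → St l) → ℝ≥0∞) : ℝ≥0∞ :=
  ∫⁻ y : Fin n → St l, f y * nnFilter Q Ψ (List.ofFn y) μ₀ Set.univ

/-- Law at time `n` of the homogeneous Markov chain with kernel `Q` started at `x`. -/
def chainLaw {d : ℕ} (Q : Kernel (St d) (St d)) (x : St d) : ℕ → Measure (St d)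
  | 0 => Measure.dirac x
  | n + 1 => (chainLaw Q x n).bind fun z => Q z

/-- `survLaw Q R x n` is the law at time `n` of the chain started at `x` and killed
when entering the closed ball of radius `R`; thus `survLaw Q R x n {z | R < ‖z‖}`
is the probability that the hitting time `τ̂_R` exceeds `n`. -/
def survLaw {d : ℕ} (Q : Kernel (St d) (St d)) (R : ℝ) (x : St d) : ℕ → Measure (St d)
  | 0 => Measure.dirac x
  | n + 1 => ((survLaw Q R x n).restrict {z | R < ‖z‖}).bind fun z => Q z

/-- `E_x exp(λ τ̂_R)`, via the identity `e^{λτ} = 1 + (e^λ - 1) ∑_{n<τ} e^{λn}`. -/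
def expHit {d : ℕ} (Q : Kernel (St d) (St d)) (R lam : ℝ) (x : St d) : ℝ≥0∞ :=
  1 + ENNReal.ofReal (Real.exp lam - 1) *
      ∑' n : ℕ, ENNReal.ofReal (Real.exp (lam * n)) * survLaw Q R x n {z | R < ‖z‖}

/-- Law at time `n` of the time-inhomogeneous Markov chain whose `i`-th step uses
the kernel `P i` (steps `1, …, n`), started at `x`. -/
def chainLawSeq {α : Type*} [MeasurableSpace α] (P : ℕ → Kernel α α) (x : α) :
    ℕ → Measure α
  | 0 => Measure.dirac x
  | n + 1 => (chainLawSeq P x n).bind fun z => P (n + 1) z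

/-- Composition of a list of (sub-)kernels given as measure-valued maps, applied at `x`. -/
def condComp {α : Type*} [MeasurableSpace α] (ks : List (α → Measure α)) (x : α) :
    Measure α :=
  ks.foldl (fun m k => m.bind k) (Measure.dirac x)

/-- The list of observations `y_{k+1}, …, y_n` (in chronological order). -/
def obsList {l : ℕ} (y : ℕ → St l) (k n : ℕ) : List (St l) :=
  (List.range (n - k)).map fun i => y (k + 1 + i)

/-- The wrong filter `μ'_k`, defined recursively by one-step normalized updates with the
wrong kernel `P` and wrong observation density `Ξ`. -/
def wrongFilter {d l : ℕ} (P : Kernel (St d) (St d)) (Ξ : St d → St l → ℝ)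
    (y : ℕ → St l) (μ₀ : Measure (St d)) : ℕ → Measure (St d)
  | 0 => μ₀
  | k + 1 => stepBar P Ξ (y (k + 1)) (wrongFilter P Ξ y μ₀ k)

end

theorem measurable_expW {d : ℕ} (c : ℝ) : Measurable (expW c : St d → ℝ≥0∞) := by
  unfold expW
  fun_prop

theorem measurableSet_lt_norm {d : ℕ} (R : ℝ) : MeasurableSet {z : St d | R < ‖z‖} :=
  measurableSet_lt measurable_const measurable_norm

theorem one_le_expW {d : ℕ} {c : ℝ} (hc : 0 ≤ c) (x : St d) : 1 ≤ expW c x :=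
  ENNReal.one_le_ofReal.2 (Real.one_le_exp (by positivity))

/-- Under the drift condition, the exponential moment of the killed chain outside the ball
decays geometrically. -/
theorem setLIntegral_expW_survLaw_le {d : ℕ} {Q : Kernel (St d) (St d)} {c ρ R K : ℝ}
    (hρ : 0 ≤ ρ) (hA4 : DriftCond Q c ρ R K) (x : St d) (n : ℕ) :
    ∫⁻ z in {z | R < ‖z‖}, expW c z ∂(survLaw Q R x n) ≤ ENNReal.ofReal ρ ^ n * expW c x := by
  induction n with
  | zero =>
    refine (setLIntegral_le_lintegral _ _).trans ?_
    simp [survLaw, lintegral_dirac' _ (measurable_expW c)]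
  | succ n ih =>
    refine (setLIntegral_le_lintegral _ _).trans ?_
    rw [survLaw, Measure.lintegral_bind Q.measurable.aemeasurable
      (measurable_expW c).aemeasurable]
    calc ∫⁻ z in {z | R < ‖z‖}, ∫⁻ y, expW c y ∂(Q z) ∂(survLaw Q R x n)
        ≤ ∫⁻ z in {z | R < ‖z‖}, ENNReal.ofReal ρ * expW c z ∂(survLaw Q R x n) := by
          refine setLIntegral_mono' (measurableSet_lt_norm R) fun z hz => ?_
          rw [expW, ← ENNReal.ofReal_mul hρ]
          exact hA4.1 z (le_of_lt hz)
      _ = ENNReal.ofReal ρ * ∫⁻ z in {z | R < ‖z‖}, expW c z ∂(survLaw Q R x n) :=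
          lintegral_const_mul _ (measurable_expW c)
      _ ≤ ENNReal.ofReal ρ ^ (n + 1) * expW c x := by
          rw [pow_succ', mul_assoc]
          gcongr

/-- Geometric tail bound for the hitting time of the ball. -/
theorem survLaw_lt_norm_le {d : ℕ} {Q : Kernel (St d) (St d)} {c ρ R K : ℝ} (hc : 0 ≤ c)
    (hρ : 0 ≤ ρ) (hA4 : DriftCond Q c ρ R K) (x : St d) (n : ℕ) :
    survLaw Q R x n {z | R < ‖z‖} ≤ ENNReal.ofReal ρ ^ n * expW c x := by
  refine le_trans ?_ (setLIntegral_expW_survLaw_le hρ hA4 x n)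
  rw [← setLIntegral_one]
  exact lintegral_mono fun z => one_le_expW hc z

theorem exp_moment_of_hitting_time {d : ℕ} (Q : Kernel (St d) (St d)) [IsMarkovKernel Q]
    (c ρ R K : ℝ) (hc : 0 < c) (hρ : ρ ∈ Set.Ioo (0 : ℝ) 1) (hR : 0 < R) (hK : 0 < K)
    (hA4 : DriftCond Q c ρ R K) :
    ∃ C > (0 : ℝ), ∃ lam > (0 : ℝ), ∀ x : St d,
      expHit Q R lam x ≤ ENNReal.ofReal (C * Real.exp (c * ‖x‖)) := by
  obtain ⟨hρ0, hρ1⟩ := hρ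
  set s := √ρ with hs
  have hs0 : 0 < s := Real.sqrt_pos.2 hρ0
  have hs1 : s < 1 := by rw [hs, Real.sqrt_lt' one_pos]; simpa using hρ1
  have hss : s * s = ρ := Real.mul_self_sqrt hρ0.le
  have hexp : Real.exp (-Real.log s) = s⁻¹ := by rw [Real.exp_neg, Real.exp_log hs0]
  have hinv : 0 ≤ s⁻¹ - 1 := sub_nonneg.2 ((one_le_inv₀ hs0).2 hs1.le)
  have hgeo : 0 ≤ (1 - s)⁻¹ := inv_nonneg.2 (sub_nonneg.2 hs1.le)
  refine ⟨1 + (s⁻¹ - 1) * (1 - s)⁻¹, by positivity, -Real.log s,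
    neg_pos.2 (Real.log_neg hs0 hs1), fun x => ?_⟩
  have hterm (n : ℕ) : ENNReal.ofReal (Real.exp (-Real.log s * n)) *
      survLaw Q R x n {z | R < ‖z‖} ≤ ENNReal.ofReal s ^ n * expW c x := by
    calc _ ≤ ENNReal.ofReal (Real.exp (-Real.log s * n)) *
          (ENNReal.ofReal ρ ^ n * expW c x) := by
          gcongr
          exact survLaw_lt_norm_le hc.le hρ0.le hA4 x n
      _ = ENNReal.ofReal s ^ n * expW c x := by
          rw [← mul_assoc, mul_comm _ (n : ℝ), Real.exp_nat_mul, hexp,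
            ENNReal.ofReal_pow (by positivity), ← mul_pow,
            ← ENNReal.ofReal_mul (by positivity), ← hss, inv_mul_cancel_left₀ hs0.ne']
  have hsum : ∑' n : ℕ, ENNReal.ofReal (Real.exp (-Real.log s * n)) *
      survLaw Q R x n {z | R < ‖z‖} ≤ ENNReal.ofReal (1 - s)⁻¹ * expW c x := by
    refine (ENNReal.tsum_le_tsum hterm).trans_eq ?_
    rw [ENNReal.tsum_mul_right, ENNReal.tsum_geometric,
      ENNReal.ofReal_inv_of_pos (sub_pos.2 hs1), ENNReal.ofReal_sub _ hs0.le,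
      ENNReal.ofReal_one]
  calc expHit Q R (-Real.log s) x
      ≤ expW c x + ENNReal.ofReal (s⁻¹ - 1) * (ENNReal.ofReal (1 - s)⁻¹ * expW c x) := by
        rw [expHit, hexp]
        gcongr
        exact one_le_expW hc.le x
    _ = ENNReal.ofReal ((1 + (s⁻¹ - 1) * (1 - s)⁻¹) * Real.exp (c * ‖x‖)) := by
        rw [ENNReal.ofReal_mul (by positivity), ENNReal.ofReal_add zero_le_one (by positivity),
          ENNReal.ofReal_mul hinv, ENNReal.ofReal_one, add_mul, one_mul, mul_assoc, expW]
end

section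
/- Let Q be a Markov kernel on ℝ^d satisfying the drift condition (A4) with constants c > 0, ρ ∈ (0,1), R > 0, K > 0, and let Ψ : ℝ^d × ℝ^ℓ → (0,∞) be measurable with sup_{x,y,x'} Ψ(x,y)/Ψ(x',y) ≤ 1+δ for some δ > 0. Then for every y ∈ ℝ^ℓ, every probability measure μ on ℝ^d, and every x with |x| ≥ R, the conditional kernel Q̄^{y,μ} satisfies ∫ e^{c|x'|} Q̄^{y,μ}(x,dx') ≤ (1+δ) ρ e^{c|x|}. -/
open MeasureTheory ProbabilityTheory ENNReal

/-- If `Ψ(·, y)` varies by at most a factor `1 + δ`, it is bounded by `1 + δ` times the total mass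
of the non-normalized filter step started from a probability measure. -/
theorem ofReal_le_mul_step_univ {d l : ℕ} (Q : Kernel (St d) (St d)) [IsMarkovKernel Q]
    (Ψ : St d → St l → ℝ) {δ : ℝ} (hδ : 0 ≤ 1 + δ) (y : St l)
    (hΨ : ∀ x x' : St d, Ψ x y ≤ (1 + δ) * Ψ x' y)
    (μ : Measure (St d)) [IsProbabilityMeasure μ] (x : St d) :
    ENNReal.ofReal (Ψ x y) ≤ ENNReal.ofReal (1 + δ) * step Q Ψ y μ Set.univ := by
  have hbind : (μ.bind fun x => Q x) Set.univ = 1 := by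
    rw [Measure.bind_apply MeasurableSet.univ Q.measurable.aemeasurable]
    simp
  rw [step, withDensity_apply _ MeasurableSet.univ, Measure.restrict_univ,
    ← lintegral_const_mul' _ _ ENNReal.ofReal_ne_top]
  calc ENNReal.ofReal (Ψ x y)
      = ∫⁻ _, ENNReal.ofReal (Ψ x y) ∂(μ.bind fun x => Q x) := by
        rw [lintegral_const, hbind, mul_one]
    _ ≤ ∫⁻ x', ENNReal.ofReal (1 + δ) * ENNReal.ofReal (Ψ x' y) ∂(μ.bind fun x => Q x) := by
        refine lintegral_mono fun x' => ?_
        rw [← ENNReal.ofReal_mul hδ]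
        exact ENNReal.ofReal_le_ofReal (hΨ x x')

theorem condKernel_drift_large {d l : ℕ} (Q : Kernel (St d) (St d)) [IsMarkovKernel Q]
    (c ρ R K : ℝ) (hc : 0 < c) (hρ : ρ ∈ Set.Ioo (0 : ℝ) 1) (hR : 0 < R) (hK : 0 < K)
    (hA4 : DriftCond Q c ρ R K)
    (Ψ : St d → St l → ℝ) (hΨm : Measurable (Function.uncurry Ψ))
    (hΨpos : ∀ (x : St d) (y : St l), 0 < Ψ x y)
    (δ : ℝ) (hδ : 0 < δ)
    (hA5 : ∀ (x x' : St d) (y : St l), Ψ x y ≤ (1 + δ) * Ψ x' y)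
    (y : St l) (μ : Measure (St d)) [IsProbabilityMeasure μ]
    (hden0 : 0 < step Q Ψ y μ Set.univ) (hdenT : step Q Ψ y μ Set.univ ≠ ⊤)
    (x : St d) (hx : R ≤ ‖x‖) :
    ∫⁻ x', expW c x' ∂(condBar Q Ψ y μ x)
      ≤ ENNReal.ofReal ((1 + δ) * ρ * Real.exp (c * ‖x‖)) := by
  have hδ' : 0 ≤ 1 + δ := by linarith
  have hm : Measurable fun x' => ENNReal.ofReal (Ψ x' y) :=
    (hΨm.comp (measurable_id.prodMk measurable_const)).ennreal_ofReal
  have hw : Measurable (expW c : St d → ℝ≥0∞) := by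
    unfold expW
    fun_prop
  rw [condBar, lintegral_smul_measure, lintegral_withDensity_eq_lintegral_mul _ hm hw, smul_eq_mul]
  set D := step Q Ψ y μ Set.univ
  calc D⁻¹ * ∫⁻ x', ENNReal.ofReal (Ψ x' y) * expW c x' ∂(Q x)
      ≤ D⁻¹ * ∫⁻ x', ENNReal.ofReal (1 + δ) * D * expW c x' ∂(Q x) := by
        gcongr with x'
        exact ofReal_le_mul_step_univ Q Ψ hδ' y (fun a b => hA5 a b y) μ x'
    _ = D⁻¹ * D * (ENNReal.ofReal (1 + δ) * ∫⁻ x', expW c x' ∂(Q x)) := by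
        rw [lintegral_const_mul _ hw]
        ring
    _ = ENNReal.ofReal (1 + δ) * ∫⁻ x', expW c x' ∂(Q x) := by
        rw [ENNReal.inv_mul_cancel hden0.ne' hdenT, one_mul]
    _ ≤ ENNReal.ofReal (1 + δ) * ENNReal.ofReal (ρ * Real.exp (c * ‖x‖)) := by
        gcongr
        exact hA4.1 x hx
    _ = ENNReal.ofReal ((1 + δ) * ρ * Real.exp (c * ‖x‖)) := by
        rw [← ENNReal.ofReal_mul hδ', mul_assoc]
end

section
/- Let Q be a Markov kernel on ℝ^d, Ψ : ℝ^d × ℝ^ℓ → (0,∞) measurable, and fix observations y_{k+1},…,y_n ∈ ℝ^ℓ. For any probability measure μ on ℝ^d such that all the normalizing constants below are positive and finite, the normalized filtering operator satisfies the flow property μ S̄_{k:n} = (μ Q̄^{y_{k+1}}) S̄_{k+1:n}, where μ Q̄^{y}(dx') := ∫ Q(x,dx') Ψ(x',y) μ(dx) / ∬ Q(x,dx₁) Ψ(x₁,y) μ(dx) is the one-step normalized update. -/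
open MeasureTheory ProbabilityTheory ENNReal

theorem step_smul {d l : ℕ} (Q : Kernel (St d) (St d)) (Ψ : St d → St l → ℝ) (y : St l)
    (c : ℝ≥0∞) (μ : Measure (St d)) : step Q Ψ y (c • μ) = c • step Q Ψ y μ := by
  simp only [step, Measure.bind_smul, withDensity_smul_measure]

theorem nnFilter_smul {d l : ℕ} (Q : Kernel (St d) (St d)) (Ψ : St d → St l → ℝ)
    (ys : List (St l)) (c : ℝ≥0∞) (μ : Measure (St d)) :
    nnFilter Q Ψ ys (c • μ) = c • nnFilter Q Ψ ys μ := by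
  induction ys generalizing μ with
  | nil => rfl
  | cons y ys ih => exact (congrArg (nnFilter Q Ψ ys) (step_smul Q Ψ y c μ)).trans (ih _)

theorem normalizeM_smul {α : Type*} [MeasurableSpace α] {c : ℝ≥0∞} (hc : c ≠ 0) (hc' : c ≠ ∞)
    (μ : Measure α) : normalizeM (c • μ) = normalizeM μ := by
  rw [normalizeM, normalizeM, Measure.smul_apply, smul_eq_mul, smul_smul,
    ENNReal.mul_inv (.inl hc) (.inl hc'), mul_right_comm, ENNReal.inv_mul_cancel hc hc', one_mul]

theorem obsList_eq_cons {l : ℕ} (y : ℕ → St l) {k n : ℕ} (hkn : k < n) :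
    obsList y k n = y (k + 1) :: obsList y (k + 1) n := by
  have h : n - k = n - (k + 1) + 1 := by omega
  simp only [obsList, h, List.range_succ_eq_map, List.map_cons, List.map_map, add_zero]
  congr 2
  funext i
  simp only [Function.comp_apply]
  congr 1
  omega

theorem nFilter_flow_property {d l : ℕ}
    (Q : Kernel (St d) (St d)) [IsMarkovKernel Q]
    (Ψ : St d → St l → ℝ) (hΨm : Measurable (Function.uncurry Ψ))
    (hΨpos : ∀ (x : St d) (y : St l), 0 < Ψ x y)
    (y : ℕ → St l) (k n : ℕ) (hkn : k < n)
    (μ : Measure (St d)) [IsProbabilityMeasure μ]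
    (h1 : 0 < step Q Ψ (y (k + 1)) μ Set.univ)
    (h1' : step Q Ψ (y (k + 1)) μ Set.univ ≠ ⊤)
    (h2 : 0 < nnFilter Q Ψ (obsList y k n) μ Set.univ)
    (h2' : nnFilter Q Ψ (obsList y k n) μ Set.univ ≠ ⊤)
    (h3 : 0 < nnFilter Q Ψ (obsList y (k + 1) n) (stepBar Q Ψ (y (k + 1)) μ) Set.univ)
    (h3' : nnFilter Q Ψ (obsList y (k + 1) n) (stepBar Q Ψ (y (k + 1)) μ) Set.univ ≠ ⊤) :
    nFilter Q Ψ (obsList y k n) μ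
      = nFilter Q Ψ (obsList y (k + 1) n) (stepBar Q Ψ (y (k + 1)) μ) := by
  rw [obsList_eq_cons y hkn, stepBar, normalizeM, nFilter, nFilter, nnFilter_smul,
    normalizeM_smul (ENNReal.inv_ne_zero.2 h1') (ENNReal.inv_ne_top.2 h1.ne')]
  rfl
end

section
/- Let Q, P be Markov kernels on ℝ^d and Ψ, Ξ : ℝ^d × ℝ^ℓ → (0,∞) measurable. Suppose there exist q₁, q₂ ≥ 0 with q₁ + q₂ = q such that for all x ∈ ℝ^d, y ∈ ℝ^ℓ and all Borel sets A: ∫_A Ψ(x',y) Q(x,dx') ≤ e^{q₁} ∫_A Ξ(x',y) P(x,dx') and ∫_A Ξ(x',y) P(x,dx') ≤ e^{q₂} ∫_A Ψ(x',y) Q(x,dx'). Then for every probability measure μ on ℝ^d and every y (with both normalizations positive and finite), the one-step normalized updates satisfy μ Q̄^{y} ≤ e^{q} μ P̄^{y} and μ P̄^{y} ≤ e^{q} μ Q̄^{y} setwise; in particular the Birkhoff distance between μ Q̄^{y} and μ P̄^{y} is at most q. -/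
open MeasureTheory ProbabilityTheory ENNReal

theorem step_apply {d l : ℕ} (Q : Kernel (St d) (St d)) {Ψ : St d → St l → ℝ}
    (hΨ : Measurable (Function.uncurry Ψ)) (y : St l) (μ : Measure (St d)) {A : Set (St d)}
    (hA : MeasurableSet A) :
    step Q Ψ y μ A = ∫⁻ x, ((Q x).withDensity fun x' => ENNReal.ofReal (Ψ x' y)) A ∂μ := by
  have hf : Measurable fun x' => ENNReal.ofReal (Ψ x' y) :=
    (hΨ.comp (measurable_id.prodMk measurable_const)).ennreal_ofReal
  simp only [step, withDensity_apply _ hA]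
  simp only [← lintegral_indicator hA]
  exact Measure.lintegral_bind Q.measurable.aemeasurable (hf.indicator hA).aemeasurable

theorem step_le_smul {d l : ℕ} {Q P : Kernel (St d) (St d)} {Ψ Ξ : St d → St l → ℝ}
    (hΨ : Measurable (Function.uncurry Ψ)) (hΞ : Measurable (Function.uncurry Ξ))
    {y : St l} {c : ℝ≥0∞} (hc : c ≠ ⊤)
    (h : ∀ (x : St d) (A : Set (St d)),
      ((Q x).withDensity fun x' => ENNReal.ofReal (Ψ x' y)) A
        ≤ c * ((P x).withDensity fun x' => ENNReal.ofReal (Ξ x' y)) A)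
    (μ : Measure (St d)) : step Q Ψ y μ ≤ c • step P Ξ y μ := by
  refine Measure.le_iff.2 fun A hA => ?_
  rw [Measure.smul_apply, smul_eq_mul, step_apply Q hΨ y μ hA, step_apply P hΞ y μ hA,
    ← lintegral_const_mul' _ _ hc]
  exact lintegral_mono fun x => h x A

theorem normalizeM_apply_le {α : Type*} [MeasurableSpace α] {μ ν : Measure α} {c : ℝ≥0∞}
    (h : μ ≤ c • ν) (hν0 : ν Set.univ ≠ 0) (hνT : ν Set.univ ≠ ⊤) (A : Set α) :
    normalizeM μ A ≤ c * (ν Set.univ / μ Set.univ) * normalizeM ν A := by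
  simp only [normalizeM, Measure.smul_apply, smul_eq_mul]
  calc (μ Set.univ)⁻¹ * μ A ≤ (μ Set.univ)⁻¹ * (c * ν A) := by gcongr; exact h A
    _ = (ν Set.univ * (ν Set.univ)⁻¹) * ((μ Set.univ)⁻¹ * (c * ν A)) := by
      rw [ENNReal.mul_inv_cancel hν0 hνT, one_mul]
    _ = _ := by rw [div_eq_mul_inv]; ring

theorem normalizeM_apply_le_mul {α : Type*} [MeasurableSpace α] {μ ν : Measure α}
    {c c' : ℝ≥0∞} (h : μ ≤ c • ν) (h' : ν ≤ c' • μ) (hν0 : ν Set.univ ≠ 0)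
    (hνT : ν Set.univ ≠ ⊤) (A : Set α) :
    normalizeM μ A ≤ c * c' * normalizeM ν A := by
  refine (normalizeM_apply_le h hν0 hνT A).trans ?_
  gcongr
  exact ENNReal.div_le_of_le_mul (h' Set.univ)

theorem birkhoffDist_normalizeM_le {α : Type*} [MeasurableSpace α] {μ ν : Measure α}
    {a b : ℝ} (h : μ ≤ ENNReal.ofReal (Real.exp a) • ν)
    (h' : ν ≤ ENNReal.ofReal (Real.exp b) • μ) (hμ0 : μ Set.univ ≠ 0) (hμT : μ Set.univ ≠ ⊤)
    (hν0 : ν Set.univ ≠ 0) (hνT : ν Set.univ ≠ ⊤) :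
    birkhoffDist (normalizeM μ) (normalizeM ν) ≤ ENNReal.ofReal (a + b) := by
  set r : ℝ := (ν Set.univ / μ Set.univ).toReal with hr_def
  have hrT : ν Set.univ / μ Set.univ ≠ ⊤ := ENNReal.div_ne_top hνT hμ0
  have hr : ENNReal.ofReal r = ν Set.univ / μ Set.univ := ENNReal.ofReal_toReal hrT
  have hr0 : 0 < r := ENNReal.toReal_pos (ENNReal.div_pos hν0 hμT).ne' hrT
  have hr' : ENNReal.ofReal r⁻¹ = μ Set.univ / ν Set.univ := by
    rw [ENNReal.ofReal_inv_of_pos hr0, hr, ENNReal.inv_div (.inl hμT) (.inl hμ0)]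
  refine (iInf₂_le (Real.exp a * r) (Real.exp (-b) * r)).trans <|
    (iInf₂_le (by positivity) fun A => ?_).trans <| (iInf_le _ fun A => ?_).trans_eq ?_
  · rw [ENNReal.ofReal_mul (Real.exp_nonneg a), hr]
    exact normalizeM_apply_le h hν0 hνT A
  · calc ENNReal.ofReal (Real.exp (-b) * r) * normalizeM ν A
        ≤ ENNReal.ofReal (Real.exp (-b) * r) *
          (ENNReal.ofReal (Real.exp b) * ENNReal.ofReal r⁻¹ * normalizeM μ A) := by
          rw [hr']
          gcongr
          exact normalizeM_apply_le h' hμ0 hμT A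
      _ = ENNReal.ofReal (Real.exp (-b) * r * (Real.exp b * r⁻¹)) * normalizeM μ A := by
          rw [ENNReal.ofReal_mul (p := Real.exp (-b) * r) (by positivity),
            ENNReal.ofReal_mul (p := Real.exp b) (by positivity)]
          ring
      _ = normalizeM μ A := by
          rw [show Real.exp (-b) * r * (Real.exp b * r⁻¹) = 1 by
            rw [Real.exp_neg]; field_simp]
          simp
  · rw [mul_div_mul_right _ _ hr0.ne', ← Real.exp_sub, Real.log_exp, sub_neg_eq_add]

theorem one_step_updates_birkhoff_close {d l : ℕ}
    (Q P : Kernel (St d) (St d)) [IsMarkovKernel Q] [IsMarkovKernel P]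
    (Ψ Ξ : St d → St l → ℝ)
    (hΨm : Measurable (Function.uncurry Ψ)) (hΞm : Measurable (Function.uncurry Ξ))
    (hΨpos : ∀ (x : St d) (y : St l), 0 < Ψ x y)
    (hΞpos : ∀ (x : St d) (y : St l), 0 < Ξ x y)
    (q q₁ q₂ : ℝ) (hq₁ : 0 ≤ q₁) (hq₂ : 0 ≤ q₂) (hq : q₁ + q₂ = q)
    (hdom1 : ∀ (x : St d) (y : St l) (A : Set (St d)),
      ((Q x).withDensity fun x' => ENNReal.ofReal (Ψ x' y)) A
        ≤ ENNReal.ofReal (Real.exp q₁) *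
          ((P x).withDensity fun x' => ENNReal.ofReal (Ξ x' y)) A)
    (hdom2 : ∀ (x : St d) (y : St l) (A : Set (St d)),
      ((P x).withDensity fun x' => ENNReal.ofReal (Ξ x' y)) A
        ≤ ENNReal.ofReal (Real.exp q₂) *
          ((Q x).withDensity fun x' => ENNReal.ofReal (Ψ x' y)) A)
    (μ : Measure (St d)) [IsProbabilityMeasure μ] (y : St l)
    (hQ0 : 0 < step Q Ψ y μ Set.univ) (hQT : step Q Ψ y μ Set.univ ≠ ⊤)
    (hP0 : 0 < step P Ξ y μ Set.univ) (hPT : step P Ξ y μ Set.univ ≠ ⊤) :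
    (∀ A : Set (St d),
      stepBar Q Ψ y μ A ≤ ENNReal.ofReal (Real.exp q) * stepBar P Ξ y μ A) ∧
    (∀ A : Set (St d),
      stepBar P Ξ y μ A ≤ ENNReal.ofReal (Real.exp q) * stepBar Q Ψ y μ A) ∧
    birkhoffDist (stepBar Q Ψ y μ) (stepBar P Ξ y μ) ≤ ENNReal.ofReal q := by
  have h₁ := step_le_smul hΨm hΞm ofReal_ne_top (fun x => hdom1 x y) μ
  have h₂ := step_le_smul hΞm hΨm ofReal_ne_top (fun x => hdom2 x y) μ
  have hexp : ENNReal.ofReal (Real.exp q) =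
      ENNReal.ofReal (Real.exp q₁) * ENNReal.ofReal (Real.exp q₂) := by
    rw [← hq, Real.exp_add, ENNReal.ofReal_mul (Real.exp_nonneg q₁)]
  refine ⟨fun A => ?_, fun A => ?_, ?_⟩
  · rw [hexp]
    exact normalizeM_apply_le_mul h₁ h₂ hP0.ne' hPT A
  · rw [hexp, mul_comm (ENNReal.ofReal (Real.exp q₁))]
    exact normalizeM_apply_le_mul h₂ h₁ hQ0.ne' hQT A
  · rw [← hq]
    exact birkhoffDist_normalizeM_le h₁ h₂ hQ0.ne' hQT hP0.ne' hPT
end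

section
/- Let P be a Markov kernel on ℝ^d satisfying the drift condition (A4) with constants c > 0, ρ ∈ (0,1), R > 0, K > 0, and let Ξ : ℝ^d × ℝ^ℓ → (0,∞) be measurable with sup_{x,y,x'} Ξ(x,y)/Ξ(x',y) ≤ 1+δ for some δ > 0. Then for every probability measure μ on ℝ^d and every y ∈ ℝ^ℓ (with the normalization positive and finite), the one-step normalized update satisfies ∫ e^{c|x'|} (μ P̄^{y})(dx') ≤ (1+δ)ρ ∫ e^{c|x|} μ(dx) + (1+δ)K. -/
open MeasureTheory ProbabilityTheory ENNReal

theorem DriftCond.lintegral_expW_le {d : ℕ} {Q : Kernel (St d) (St d)} {c ρ R K : ℝ}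
    (h : DriftCond Q c ρ R K) (hρ : 0 ≤ ρ) (x : St d) :
    ∫⁻ x', expW c x' ∂(Q x) ≤ ENNReal.ofReal ρ * expW c x + ENNReal.ofReal K := by
  rcases le_total R ‖x‖ with hx | hx
  · refine (h.1 x hx).trans ?_
    rw [ENNReal.ofReal_mul hρ]
    exact le_self_add
  · exact (h.2 x hx).trans le_add_self

theorem DriftCond.lintegral_expW_bind_le {d : ℕ} {Q : Kernel (St d) (St d)} {c ρ R K : ℝ}
    (h : DriftCond Q c ρ R K) (hρ : 0 ≤ ρ) (μ : Measure (St d)) [IsProbabilityMeasure μ] :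
    ∫⁻ x', expW c x' ∂(μ.bind fun x => Q x)
      ≤ ENNReal.ofReal ρ * (∫⁻ x, expW c x ∂μ) + ENNReal.ofReal K := by
  rw [Measure.lintegral_bind Q.measurable.aemeasurable (measurable_expW c).aemeasurable]
  refine (lintegral_mono (h.lintegral_expW_le hρ)).trans_eq ?_
  rw [lintegral_add_right _ measurable_const, lintegral_const_mul _ (measurable_expW c),
    lintegral_const, measure_univ, mul_one]

/-- Reweighting a probability measure by a density of bounded oscillation and normalizing
increases integrals by at most the oscillation factor. -/
theorem lintegral_normalizeM_withDensity_le {α : Type*} [MeasurableSpace α] (ν : Measure α)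
    [IsProbabilityMeasure ν] {g f : α → ℝ≥0∞} {C : ℝ≥0∞} (hg : Measurable g)
    (hf : Measurable f) (hgC : ∀ x x', g x ≤ C * g x')
    (h0 : ν.withDensity g Set.univ ≠ 0) (hT : ν.withDensity g Set.univ ≠ ⊤) :
    ∫⁻ x, f x ∂(normalizeM (ν.withDensity g)) ≤ C * ∫⁻ x, f x ∂ν := by
  have hbound : ∀ x, g x ≤ C * ν.withDensity g Set.univ := fun x => by
    rw [withDensity_apply _ MeasurableSet.univ, Measure.restrict_univ,
      ← lintegral_const_mul _ hg]
    calc g x = ∫⁻ _, g x ∂ν := by simp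
      _ ≤ ∫⁻ x', C * g x' ∂ν := lintegral_mono (hgC x)
  rw [normalizeM, lintegral_smul_measure, lintegral_withDensity_eq_lintegral_mul _ hg hf,
    smul_eq_mul]
  set Z := ν.withDensity g Set.univ
  calc Z⁻¹ * ∫⁻ x, (g * f) x ∂ν ≤ Z⁻¹ * ∫⁻ x, C * Z * f x ∂ν := by
        gcongr with x
        exact mul_le_mul_left (hbound x) (f x)
    _ = Z⁻¹ * Z * (C * ∫⁻ x, f x ∂ν) := by
        rw [lintegral_const_mul _ hf]
        ring
    _ = C * ∫⁻ x, f x ∂ν := by rw [ENNReal.inv_mul_cancel h0 hT, one_mul]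

theorem one_step_update_exp_moment {d l : ℕ}
    (P : Kernel (St d) (St d)) [IsMarkovKernel P]
    (c ρ R K : ℝ) (hc : 0 < c) (hρ : ρ ∈ Set.Ioo (0 : ℝ) 1) (hR : 0 < R) (hK : 0 < K)
    (hA4 : DriftCond P c ρ R K)
    (Ξ : St d → St l → ℝ) (hΞm : Measurable (Function.uncurry Ξ))
    (hΞpos : ∀ (x : St d) (y : St l), 0 < Ξ x y)
    (δ : ℝ) (hδ : 0 < δ)
    (hA5 : ∀ (x x' : St d) (y : St l), Ξ x y ≤ (1 + δ) * Ξ x' y)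
    (μ : Measure (St d)) [IsProbabilityMeasure μ] (y : St l)
    (hden0 : 0 < step P Ξ y μ Set.univ) (hdenT : step P Ξ y μ Set.univ ≠ ⊤) :
    ∫⁻ x', expW c x' ∂(stepBar P Ξ y μ)
      ≤ ENNReal.ofReal ((1 + δ) * ρ) * (∫⁻ x, expW c x ∂μ)
          + ENNReal.ofReal ((1 + δ) * K) := by
  have hδ' : 0 ≤ 1 + δ := by linarith
  have : IsProbabilityMeasure (μ.bind fun x => P x) :=
    inferInstanceAs (IsProbabilityMeasure (μ.bind P))
  have hg : Measurable fun x => ENNReal.ofReal (Ξ x y) :=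
    (hΞm.comp measurable_prodMk_right).ennreal_ofReal
  have hosc : ∀ x x', ENNReal.ofReal (Ξ x y)
      ≤ ENNReal.ofReal (1 + δ) * ENNReal.ofReal (Ξ x' y) := fun x x' => by
    rw [← ENNReal.ofReal_mul hδ']
    exact ENNReal.ofReal_le_ofReal (hA5 x x' y)
  calc ∫⁻ x', expW c x' ∂(stepBar P Ξ y μ)
      ≤ ENNReal.ofReal (1 + δ) * ∫⁻ x', expW c x' ∂(μ.bind fun x => P x) :=
        lintegral_normalizeM_withDensity_le _ hg (measurable_expW c) hosc hden0.ne' hdenT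
    _ ≤ ENNReal.ofReal (1 + δ)
          * (ENNReal.ofReal ρ * (∫⁻ x, expW c x ∂μ) + ENNReal.ofReal K) := by
        gcongr
        exact hA4.lintegral_expW_bind_le hρ.1.le μ
    _ = _ := by rw [ENNReal.ofReal_mul hδ', ENNReal.ofReal_mul hδ', mul_add, mul_assoc]
end
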